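/- arXiv:1606.02751 — 2 statements merged into one kernel-verified Lean document; each statement's English description precedes it below -/
import Mathlib

section
/- Let C > 0 and define φ_C(z) = z + C·√(1+z) for complex z with Re z > −1, and ψ_C(z) = z + C²/2 − C·√(1 + z + C²/4), where √ is the principal branch of the square root. Then for every z with Re z > −1, the point φ_C(z) again has real part > −1 and ψ_C(φ_C(z)) = z; in particular φ_C is injective on the half-plane {z : Re z > −1}. -/
open Complex Filter

/-- The map `φ_C(z) = z + C·√(1+z)`, with the principal branch of the square root. -/
noncomputable def phiC (C : ℝ) (z : ℂ) : ℂ := z + (C : ℂ) * (1 + z) ^ ((1 : ℂ) / 2)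

/-- The map `ψ_C(z) = z + C²/2 − C·√(1 + z + C²/4)`. -/
noncomputable def psiC (C : ℝ) (z : ℂ) : ℂ :=
  z + (C : ℂ) ^ 2 / 2 - (C : ℂ) * (1 + z + (C : ℂ) ^ 2 / 4) ^ ((1 : ℂ) / 2)

theorem cpow_one_div_two_re_nonneg (w : ℂ) : 0 ≤ (w ^ ((1 : ℂ) / 2)).re := by
  rw [one_div, cpow_inv_two_re]
  exact Real.sqrt_nonneg _

theorem stmt_0 (C : ℝ) (hC : 0 < C) :
    (∀ z : ℂ, -1 < z.re → -1 < (phiC C z).re ∧ psiC C (phiC C z) = z) ∧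
    Set.InjOn (phiC C) {z : ℂ | -1 < z.re} := by
  have key : ∀ z : ℂ, -1 < z.re → -1 < (phiC C z).re ∧ psiC C (phiC C z) = z := by
    intro z hz
    have hre : 0 ≤ ((1 + z) ^ ((1 : ℂ) / 2)).re := cpow_one_div_two_re_nonneg (1 + z)
    have hsq : ((1 + z) ^ ((1 : ℂ) / 2)) ^ 2 = 1 + z := by
      rw [one_div]
      exact cpow_ofNat_inv_pow (1 + z) 2
    unfold psiC phiC
    generalize (1 + z) ^ ((1 : ℂ) / 2) = s at hre hsq ⊢
    constructor
    · rw [add_re, re_ofReal_mul]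
      nlinarith [mul_nonneg hC.le hre]
    · have hpos : 0 < (s + ((C / 2 : ℝ) : ℂ)).re := by
        rw [add_re, ofReal_re]
        linarith
      have hroot : (1 + (z + C * s) + (C : ℂ) ^ 2 / 4) ^ ((1 : ℂ) / 2) = s + ((C / 2 : ℝ) : ℂ) := by
        rw [← sq_cpow_two_inv hpos, one_div]
        congr 1
        push_cast
        linear_combination -hsq
      rw [hroot]
      push_cast
      ring
  exact ⟨key, Set.LeftInvOn.injOn fun z hz => (key z hz).2⟩
end

section
/- Let C > 0 and define φ_C(z) = z + C·√(1+z) (principal branch of the square root). Then there exists a continuous function f_C : [C, +∞) → ℝ which is positive on (C, +∞), such that Im(φ_C(i·x)) = f_C(Re(φ_C(i·x))) for every real x > 0, and f_C(t) / (2·(t/C)²) → 1 as t → +∞. -/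
open Complex Filter

/-- The principal square root of a complex number squares back to that number. -/
lemma cpow_half_sq (z : ℂ) : (z ^ ((1 : ℂ) / 2)) ^ 2 = z := by
  simp

/-- The principal square root of a point of the open right half-plane has positive real part. -/
lemma cpow_half_re_pos {z : ℂ} (hz : 0 < z.re) : 0 < (z ^ ((1 : ℂ) / 2)).re := by
  have hz0 : z ≠ 0 := by
    rintro rfl
    simp at hz
  have him : (Complex.log z * ((1 : ℂ) / 2)).im = z.arg / 2 := by
    rw [show (1 : ℂ) / 2 = ((1 / 2 : ℝ) : ℂ) by push_cast; rfl, Complex.im_mul_ofReal,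
      Complex.log_im]
    ring
  rw [Complex.cpow_def_of_ne_zero hz0, Complex.exp_re, him]
  refine mul_pos (Real.exp_pos _) (Real.cos_pos_of_mem_Ioo ⟨?_, ?_⟩)
  · linarith [Complex.neg_pi_lt_arg z]
  · have := Complex.abs_arg_lt_pi_div_two_iff.2 (Or.inl hz)
    linarith [le_abs_self z.arg, Real.pi_pos]

theorem stmt_2 (C : ℝ) (hC : 0 < C) :
    ∃ f : ℝ → ℝ, ContinuousOn f (Set.Ici C) ∧
      (∀ t ∈ Set.Ioi C, 0 < f t) ∧
      (∀ x : ℝ, 0 < x → (phiC C (Complex.I * x)).im = f ((phiC C (Complex.I * x)).re)) ∧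
      Tendsto (fun t : ℝ => f t / (2 * (t / C) ^ 2)) atTop (nhds 1) := by
  refine ⟨fun t => √((t / C) ^ 2 - 1) * (2 * (t / C) + C), by fun_prop, ?_, ?_, ?_⟩
  · intro t ht
    have hu : 1 < t / C := (one_lt_div hC).2 ht
    have : 0 < (t / C) ^ 2 - 1 := by nlinarith
    positivity
  · intro x hx
    have hsq := cpow_half_sq (1 + Complex.I * x)
    have ha : 0 < ((1 + Complex.I * x : ℂ) ^ ((1 : ℂ) / 2)).re := cpow_half_re_pos (by simp)
    unfold phiC
    generalize (1 + Complex.I * x : ℂ) ^ ((1 : ℂ) / 2) = w at hsq ha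
    have hre := congrArg Complex.re hsq
    have him := congrArg Complex.im hsq
    simp [pow_two] at hre him
    have hb : 0 < w.im := by
      by_contra! h
      nlinarith
    have hdiv : C * w.re / C = w.re := by field_simp
    have hroot : √(w.re ^ 2 - 1) = w.im := by
      rw [show w.re ^ 2 - 1 = w.im ^ 2 by linarith, Real.sqrt_sq hb.le]
    simp [hdiv, hroot]
    linarith
  · have hu : Tendsto (fun t : ℝ => (t / C)⁻¹) atTop (nhds 0) :=
      tendsto_inv_atTop_zero.comp (tendsto_id.atTop_div_const hC)
    have hlim : Tendsto (fun t : ℝ => √(1 - (t / C)⁻¹ ^ 2) * (1 + C / 2 * (t / C)⁻¹))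
        atTop (nhds 1) := by
      have hcont : Continuous fun v : ℝ => √(1 - v ^ 2) * (1 + C / 2 * v) := by fun_prop
      simpa [Function.comp_def] using (hcont.tendsto 0).comp hu
    refine hlim.congr' ?_
    filter_upwards [eventually_gt_atTop 0] with t ht
    have hpos : 0 < t / C := div_pos ht hC
    generalize t / C = u at hpos
    have hroot : √(u ^ 2 - 1) = u * √(1 - u⁻¹ ^ 2) := by
      rw [show u ^ 2 - 1 = u ^ 2 * (1 - u⁻¹ ^ 2) by field_simp,
        Real.sqrt_mul (sq_nonneg u), Real.sqrt_sq hpos.le]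
    rw [hroot]
    field_simp
end
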